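/- Let b be a nonzero integer divisible by 5, let R = Z[X]/(X^5 + 4*b^4*X - 1), θ the class of X in R, and let ξ_1 = θ and ξ_2 = θ^2 + 2*b*θ + 2*b^2, which are units of R. Suppose n_1, n_2, m, n are integers such that ξ_1^{n_1}·ξ_2^{n_2} = m - n*θ in R. Then n_2 is divisible by 5, and n_1 is congruent to 0 or 1 modulo 5. -/

import Mathlib

open Polynomial

/-- The polynomial `X^5 + 4*b^4*X - 1` over `ℤ`, so that `AdjoinRoot (thuePoly b)` is the ring
`R = ℤ[X]/(X^5 + 4*b^4*X - 1)`. -/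
noncomputable def thuePoly (b : ℤ) : ℤ[X] := X ^ 5 + C (4 * b ^ 4) * X - 1

/-- In a commutative ring where `b ^ 3 = 0`, the truncated exponential
`x ^ (n₁ + 2 * n₂) * (1 + 2 * b * n₂ * x⁻¹ + 2 * b ^ 2 * n₂ ^ 2 * x⁻²)` evaluates the products
of powers of `x` and `x ^ 2 + 2 * b * x + 2 * b ^ 2`. -/
theorem zpow_mul_zpow_eq_of_cube_eq_zero {A : Type*} [CommRing A] (b : A) (hb : b ^ 3 = 0)
    (x y : Aˣ) (hy : (y : A) = (x : A) ^ 2 + 2 * b * (x : A) + 2 * b ^ 2) (n₁ n₂ : ℤ) :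
    ((x ^ n₁ * y ^ n₂ : Aˣ) : A) = ((x ^ (n₁ + 2 * n₂) : Aˣ) : A) +
      2 * b * n₂ * ((x ^ (n₁ + 2 * n₂ - 1) : Aˣ) : A) +
      2 * b ^ 2 * n₂ ^ 2 * ((x ^ (n₁ + 2 * n₂ - 2) : Aˣ) : A) := by
  let t : A := ((x⁻¹ : Aˣ) : A)
  have hxt : (x : A) * t = 1 := x.mul_inv
  let f : Multiplicative ℤ →* A :=
    { toFun := fun k => 1 + 2 * b * (k.toAdd : A) * t + 2 * b ^ 2 * (k.toAdd : A) ^ 2 * t ^ 2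
      map_one' := by simp
      map_mul' := fun j k => by
        simp only [toAdd_mul, Int.cast_add]
        linear_combination (-4 * t ^ 3 * ((j.toAdd : A) * (k.toAdd : A) ^ 2 +
          (k.toAdd : A) * (j.toAdd : A) ^ 2) -
          4 * b * t ^ 4 * (j.toAdd : A) ^ 2 * (k.toAdd : A) ^ 2) * hb }
  let F : Multiplicative ℤ →* Aˣ := f.toHomUnits
  have hyF : y = x ^ (2 : ℤ) * F (Multiplicative.ofAdd 1) := by
    ext
    simp only [F, f, Units.val_mul, MonoidHom.coe_toHomUnits, MonoidHom.coe_mk, OneHom.coe_mk,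
      toAdd_ofAdd, Int.cast_one, zpow_ofNat, Units.val_pow_eq_pow_val]
    linear_combination hy - (2 * b * x + 2 * b ^ 2 * (x * t + 1)) * hxt
  have hF : F (Multiplicative.ofAdd 1) ^ n₂ = F (Multiplicative.ofAdd n₂) := by
    rw [← map_zpow, ← ofAdd_zsmul, smul_eq_mul, mul_one]
  have hmul : x ^ n₁ * y ^ n₂ = x ^ (n₁ + 2 * n₂) * F (Multiplicative.ofAdd n₂) := by
    rw [hyF, mul_zpow, ← zpow_mul, hF, ← mul_assoc, ← zpow_add]
  rw [hmul, zpow_sub, zpow_sub]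
  simp only [F, f, Units.val_mul, MonoidHom.coe_toHomUnits, MonoidHom.coe_mk, OneHom.coe_mk,
    toAdd_ofAdd, zpow_ofNat, ← inv_pow, Units.val_pow_eq_pow_val, t]
  ring

/-- If `5` divides a nonzero `b` and `b ^ (i + 1) ∣ 2 * b ^ i * k`, then `5 ∣ k`. -/
theorem five_dvd_of_pow_succ_dvd {b k : ℤ} (hb : b ≠ 0) (hb5 : (5 : ℤ) ∣ b) (i : ℕ)
    (h : b ^ (i + 1) ∣ 2 * b ^ i * k) : (5 : ℤ) ∣ k := by
  have h2 : b ∣ 2 * k := by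
    refine (mul_dvd_mul_iff_left (pow_ne_zero i hb)).1 ?_
    rwa [← pow_succ, mul_left_comm, ← mul_assoc]
  have := hb5.trans h2
  omega

/-- Let `b` be a nonzero integer divisible by 5, `R = ℤ[X]/(X^5 + 4*b^4*X - 1)`, `θ` the class
of `X`, and `ξ₁ = θ`, `ξ₂ = θ^2 + 2*b*θ + 2*b^2` the corresponding units of `R`. If
`n₁, n₂, m, n` are integers with `ξ₁^{n₁}·ξ₂^{n₂} = m - n*θ` in `R`, then `5 ∣ n₂` and
`n₁ ≡ 0` or `1 (mod 5)`. -/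
theorem quintic_exponent_restrictions (b : ℤ) (hb : b ≠ 0) (hb5 : (5 : ℤ) ∣ b)
    (ξ₁ ξ₂ : (AdjoinRoot (thuePoly b))ˣ)
    (hξ₁ : (ξ₁ : AdjoinRoot (thuePoly b)) = AdjoinRoot.root (thuePoly b))
    (hξ₂ : (ξ₂ : AdjoinRoot (thuePoly b)) = (AdjoinRoot.root (thuePoly b)) ^ 2 +
      2 * (b : AdjoinRoot (thuePoly b)) * AdjoinRoot.root (thuePoly b) +
      2 * (b : AdjoinRoot (thuePoly b)) ^ 2)
    (n₁ n₂ m n : ℤ)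
    (h : ((ξ₁ ^ n₁ * ξ₂ ^ n₂ : (AdjoinRoot (thuePoly b))ˣ) : AdjoinRoot (thuePoly b)) =
      (m : AdjoinRoot (thuePoly b)) -
        (n : AdjoinRoot (thuePoly b)) * AdjoinRoot.root (thuePoly b)) :
    (5 : ℤ) ∣ n₂ ∧ (n₁ % 5 = 0 ∨ n₁ % 5 = 1) := by
  let S := ZMod (b ^ 3).natAbs
  let A := AddMonoidAlgebra S (ZMod 5)
  have hS (k : ℤ) : (k : S) = 0 ↔ b ^ 3 ∣ k := by
    rw [ZMod.intCast_zmod_eq_zero_iff_dvd, Int.natAbs_dvd]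
  have hb3 : ((b : ℤ) : A) ^ 3 = 0 := by
    have h0 : ((b ^ 3 : ℤ) : S) = 0 := (hS _).2 dvd_rfl
    have h1 := congrArg (algebraMap S A) h0
    rwa [map_intCast, map_zero, Int.cast_pow] at h1
  let g : Multiplicative ℤ →* A :=
    (AddMonoidAlgebra.of S (ZMod 5)).comp (Int.castAddHom (ZMod 5)).toMultiplicative
  let X : Aˣ := g.toHomUnits (Multiplicative.ofAdd 1)
  have hX (k : ℤ) : ((X ^ k : Aˣ) : A) = AddMonoidAlgebra.single (k : ZMod 5) 1 := by
    rw [← map_zpow, ← ofAdd_zsmul, smul_eq_mul, mul_one]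
    rfl
  have hX5 : (X : A) ^ 5 = 1 := by
    have := hX 5
    rw [zpow_ofNat, Units.val_pow_eq_pow_val] at this
    exact this
  have hroot : (thuePoly b).eval₂ (Int.castRingHom A) (X : A) = 0 := by
    rw [thuePoly, eval₂_sub, eval₂_add, eval₂_mul, eval₂_pow, eval₂_X, eval₂_C, eval₂_one,
      eq_intCast, Int.cast_mul, Int.cast_pow, Int.cast_ofNat]
    linear_combination hX5 + 4 * b * X * hb3
  let φ : AdjoinRoot (thuePoly b) →+* A := AdjoinRoot.lift (Int.castRingHom A) (X : A) hroot
  have hφ : φ (AdjoinRoot.root (thuePoly b)) = X := AdjoinRoot.lift_root hroot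
  have h₁ : Units.map (φ : AdjoinRoot (thuePoly b) →* A) ξ₁ = X := by
    ext1
    rw [Units.coe_map, hξ₁]
    exact hφ
  have h₂ : ((Units.map (φ : AdjoinRoot (thuePoly b) →* A) ξ₂ : Aˣ) : A) =
      (X : A) ^ 2 + 2 * (b : A) * (X : A) + 2 * (b : A) ^ 2 := by
    rw [Units.coe_map, hξ₂, MonoidHom.coe_coe]
    simp only [map_add, map_mul, map_pow, map_ofNat, map_intCast, hφ]
  have key := zpow_mul_zpow_eq_of_cube_eq_zero (b : A) hb3 X _ h₂ n₁ n₂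
  rw [← h₁, ← map_zpow, ← map_zpow, ← map_mul, h₁, Units.coe_map, h, MonoidHom.coe_coe, map_sub,
    map_mul, map_intCast, map_intCast, hφ] at key
  have hsingle (k l : ℤ) : (k : A) * ((X ^ l : Aˣ) : A) =
      AddMonoidAlgebra.single (l : ZMod 5) (k : S) := by
    rw [hX, AddMonoidAlgebra.intCast_def, AddMonoidAlgebra.single_mul_single, zero_add, mul_one]
  have hterm (k l : ℤ) (a : ZMod 5) : ((k : A) * ((X ^ l : Aˣ) : A)).coeff a =
      if (l : ZMod 5) = a then (k : S) else 0 := by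
    rw [hsingle, AddMonoidAlgebra.coeff_single, Finsupp.single_apply]
  have hcoeff (a : ZMod 5) :
      ((if ((0 : ℤ) : ZMod 5) = a then (m : S) else 0) -
        if ((1 : ℤ) : ZMod 5) = a then (n : S) else 0) =
      (if ((n₁ + 2 * n₂ : ℤ) : ZMod 5) = a then ((1 : ℤ) : S) else 0) +
      (if ((n₁ + 2 * n₂ - 1 : ℤ) : ZMod 5) = a then ((2 * b ^ 1 * n₂ : ℤ) : S) else 0) +
      if ((n₁ + 2 * n₂ - 2 : ℤ) : ZMod 5) = a then ((2 * b ^ 2 * n₂ ^ 2 : ℤ) : S) else 0 := by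
    simp only [← hterm]
    have hsum : ((m : ℤ) : A) * ((X ^ (0 : ℤ) : Aˣ) : A) - (n : A) * ((X ^ (1 : ℤ) : Aˣ) : A) =
        ((1 : ℤ) : A) * ((X ^ (n₁ + 2 * n₂) : Aˣ) : A) +
        ((2 * b ^ 1 * n₂ : ℤ) : A) * ((X ^ (n₁ + 2 * n₂ - 1) : Aˣ) : A) +
        ((2 * b ^ 2 * n₂ ^ 2 : ℤ) : A) * ((X ^ (n₁ + 2 * n₂ - 2) : Aˣ) : A) := by
      push_cast
      simpa using key
    exact congrArg (fun z : A => z.coeff a) hsum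
  have hb1 : ¬ b ^ 3 ∣ 1 := fun hd => by
    have := (dvd_pow hb5 three_ne_zero).trans hd
    norm_num at this
  obtain ⟨r, hr0, hr5, hr⟩ : ∃ r : ℤ, 0 ≤ r ∧ r < 5 ∧ (n₁ + 2 * n₂) % 5 = r :=
    ⟨_, Int.emod_nonneg _ (by norm_num), Int.emod_lt_of_pos _ (by norm_num), rfl⟩
  have hN : ((n₁ + 2 * n₂ : ℤ) : ZMod 5) = (r : ZMod 5) := by
    rw [← hr]
    exact (ZMod.intCast_mod _ 5).symm
  simp only [Int.cast_sub, hN] at hcoeff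
  interval_cases r
  · have h4 : (0 : S) - 0 = 0 + ((2 * b ^ 1 * n₂ : ℤ) : S) + 0 := hcoeff 4
    rw [sub_zero, zero_add, add_zero, eq_comm, hS] at h4
    have h5 : (5 : ℤ) ∣ n₂ := five_dvd_of_pow_succ_dvd hb hb5 1
      ((pow_dvd_pow b (by norm_num)).trans h4)
    exact ⟨h5, by omega⟩
  · have h4 : (0 : S) - 0 = 0 + 0 + ((2 * b ^ 2 * n₂ ^ 2 : ℤ) : S) := hcoeff 4
    rw [sub_zero, zero_add, zero_add, eq_comm, hS] at h4
    have h5 : (5 : ℤ) ∣ n₂ := (Int.prime_iff_natAbs_prime.2 (by norm_num)).dvd_of_dvd_pow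
      (five_dvd_of_pow_succ_dvd hb hb5 2 h4)
    exact ⟨h5, by omega⟩
  · have h2 : (0 : S) - 0 = ((1 : ℤ) : S) + 0 + 0 := hcoeff 2
    rw [sub_zero, add_zero, add_zero, eq_comm, hS] at h2
    exact absurd h2 hb1
  · have h3 : (0 : S) - 0 = ((1 : ℤ) : S) + 0 + 0 := hcoeff 3
    rw [sub_zero, add_zero, add_zero, eq_comm, hS] at h3
    exact absurd h3 hb1
  · have h4 : (0 : S) - 0 = ((1 : ℤ) : S) + 0 + 0 := hcoeff 4
    rw [sub_zero, add_zero, add_zero, eq_comm, hS] at h4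
    exact absurd h4 hb1
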